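/- arXiv:2504.19430 — 10 statements merged into one kernel-verified Lean document; each statement's English description precedes it below -/
import Mathlib

section
/- Let A be an additive commutative group, let D : A → A be an additive map, let M be any set, let L : M → M be a map, and let f : M → A. Define c₀(λ) = 0 and, for k ≥ 1, c_k(λ) = Σ_{j=1}^{k} D^{j-1}(f(L^{k-j}(λ))). Then for all k, l ∈ ℤ_{≥0} and all λ ∈ M one has c_{k+l}(λ) = c_l(L^k(λ)) + D^l(c_k(λ)). -/
/-- Iterates of an additive endomorphism commute with finite sums. -/
theorem AddMonoidHom.iterate_map_finset_sum {A ι : Type*} [AddCommMonoid A] (D : A →+ A) (n : ℕ)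
    (s : Finset ι) (g : ι → A) :
    (⇑D)^[n] (∑ i ∈ s, g i) = ∑ i ∈ s, (⇑D)^[n] (g i) := by
  induction n with
  | zero => rfl
  | succ n ih => simp only [Function.iterate_succ_apply', ih, map_sum]


/-- The algebraic core of Proposition 4.2(i): with `c 0 = 0` and
`c k lam = ∑_{j=1}^{k} D^[j-1] (f (L^[k-j] lam))`, one has
`c (k+l) lam = c l (L^[k] lam) + D^[l] (c k lam)`. -/
theorem iterated_lie_derivative_horizontal_part_identity
    {A : Type*} [AddCommGroup A] {M : Type*}
    (D : A →+ A) (L : M → M) (f : M → A)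
    (c : ℕ → M → A)
    (hc : ∀ (k : ℕ) (lam : M),
      c k lam = ∑ j ∈ Finset.Icc 1 k, (⇑D)^[j - 1] (f (L^[k - j] lam))) :
    ∀ (k l : ℕ) (lam : M),
      c (k + l) lam = c l (L^[k] lam) + (⇑D)^[l] (c k lam) := by
  have sum_Icc_one (n : ℕ) (g : ℕ → A) :
      ∑ j ∈ Finset.Icc 1 n, g j = ∑ i ∈ Finset.range n, g (i + 1) := by
    rw [Finset.range_eq_Ico, Finset.sum_Ico_add', zero_add, Finset.Ico_add_one_right_eq_Icc]
  intro k l lam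
  simp only [hc, sum_Icc_one, Nat.add_sub_cancel]
  rw [add_comm k l, Finset.sum_range_add, D.iterate_map_finset_sum]
  congr 1
  · refine Finset.sum_congr rfl fun i hi => ?_
    have hi := Finset.mem_range.mp hi
    rw [← Function.iterate_add_apply, show l + k - (i + 1) = l - (i + 1) + k by omega]
  · refine Finset.sum_congr rfl fun i _ => ?_
    rw [← Function.iterate_add_apply, show l + k - (l + i + 1) = k - (i + 1) by omega]
end

section
/- Let V be a finite-dimensional real vector space and let Δ be a subspace of V* × ℝ of positive codimension (i.e., Δ ≠ V* × ℝ). Then there exist a linear endomorphism A : V → V and a vector b ∈ V such that Δ = Sol*(A,b) = { (A*(λ), λ(b)) : λ ∈ V* }. -/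
/-- Over a field, a subspace is the range of a linear map from any finite-dimensional space
whose dimension is at least as large. -/
theorem Submodule.exists_linearMap_range_eq_of_finrank_le {K M N : Type*} [Field K]
    [AddCommGroup M] [Module K M] [FiniteDimensional K M]
    [AddCommGroup N] [Module K N] [FiniteDimensional K N] (W : Submodule K N)
    (h : Module.finrank K W ≤ Module.finrank K M) :
    ∃ f : M →ₗ[K] N, LinearMap.range f = W := by
  obtain ⟨i, hi⟩ := finrank_le_iff_exists_linearMap.mp h
  obtain ⟨f, hfi⟩ := i.exists_leftInverse_of_injective (LinearMap.ker_eq_bot.mpr hi)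
  have hf : Function.Surjective f := LinearMap.surjective_of_comp_eq_id i f hfi
  refine ⟨W.subtype ∘ₗ f, ?_⟩
  rw [LinearMap.range_comp, LinearMap.range_eq_top.mpr hf, Submodule.map_top,
    Submodule.range_subtype]

/-- Converse correspondence: every subspace `Δ` of `V* × ℝ` of positive codimension
(i.e. `Δ ≠ ⊤`) is of the form `Sol*(A,b) = { (A*(λ), λ(b)) | λ ∈ V* }` for some
endomorphism `A : V → V` and some `b ∈ V`. -/
theorem proper_subspace_eq_solStar
    (V : Type*) [AddCommGroup V] [Module ℝ V] [FiniteDimensional ℝ V]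
    (Δ : Submodule ℝ (Module.Dual ℝ V × ℝ)) (hΔ : Δ ≠ ⊤) :
    ∃ (A : V →ₗ[ℝ] V) (b : V),
      Δ = LinearMap.range ((A.dualMap).prod (LinearMap.applyₗ b)) := by
  have hlt := Submodule.finrank_lt hΔ
  rw [Module.finrank_prod, Module.finrank_self] at hlt
  have hle : Module.finrank ℝ Δ ≤ Module.finrank ℝ (Module.Dual ℝ V) := Nat.lt_succ_iff.mp hlt
  obtain ⟨g, hg⟩ : ∃ g : Module.Dual ℝ V →ₗ[ℝ] Module.Dual ℝ V × ℝ, LinearMap.range g = Δ :=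
    Submodule.exists_linearMap_range_eq_of_finrank_le (N := Module.Dual ℝ V × ℝ) Δ hle
  let e := Module.evalEquiv ℝ V
  refine ⟨e.symm.toLinearMap ∘ₗ (LinearMap.fst ℝ _ _ ∘ₗ g).dualMap ∘ₗ e.toLinearMap,
    e.symm (LinearMap.snd ℝ _ _ ∘ₗ g), ?_⟩
  rw [← hg]
  congr 1
  ext l v
  · simp [e]
  · simp [e]
end

section
/- Let x, y, θ, φ, vₛ, vᵣ, p₁, p₂ be a solution of the regular system on an open interval I containing 0, and suppose vₛ(0) = 0, sin(θ(0)) = 0, and p₁(0) = 0. Then for every t ∈ I one has vₛ(t) = 0, sin(θ(t)) = 0, and p₁(t) = 0; in particular (vₛ(t)² + vᵣ(t)²)·p₁(t) = 0 for all t ∈ I. -/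
open Real Set

/-- A solution of the reduced ODE system governing the D-regular constrained variational
trajectories of a disc (mass `m`, radius `R`, spinning inertia `Js`, rolling inertia `Jr`)
rolling without slip on a plane inclined at angle `τ`, on a set `I ⊆ ℝ`. -/
def IsRegularSolution (m g R Js Jr τ : ℝ) (I : Set ℝ)
    (x y θ φ vs vr p₁ p₂ : ℝ → ℝ) : Prop :=
  ∀ t ∈ I,
    HasDerivAt x (R * Real.cos (θ t) * vr t / Real.sqrt (Jr + m * R ^ 2)) t ∧
    HasDerivAt y (R * Real.sin (θ t) * vr t / Real.sqrt (Jr + m * R ^ 2)) t ∧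
    HasDerivAt θ (vs t / Real.sqrt Js) t ∧
    HasDerivAt φ (vr t / Real.sqrt (Jr + m * R ^ 2)) t ∧
    HasDerivAt vs 0 t ∧
    HasDerivAt vr (m * g * R * Real.sin τ * Real.cos (θ t) / Real.sqrt (Jr + m * R ^ 2)) t ∧
    HasDerivAt p₁
      ((Real.sqrt Jr * vs t * p₂ t - 2 * Real.sqrt m * R * vs t * vr t) /
          (Real.sqrt Js * Real.sqrt (Jr + m * R ^ 2)) -
        Real.sqrt m * g * Real.sin τ * Real.sin (θ t)) t ∧
    HasDerivAt p₂
      (-(Real.sqrt Jr * vs t * p₁ t) / (Real.sqrt Js * Real.sqrt (Jr + m * R ^ 2)) -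
        Real.sqrt m * Real.sqrt Jr * g * Real.sin τ * Real.cos (θ t) /
          Real.sqrt (Jr + m * R ^ 2)) t

/-- A real function with vanishing derivative on an open interval is constant there. -/
theorem eq_of_hasDerivAt_zero_Ioo {f : ℝ → ℝ} {a b s t : ℝ}
    (hf : ∀ u ∈ Set.Ioo a b, HasDerivAt f 0 u) (hs : s ∈ Set.Ioo a b) (ht : t ∈ Set.Ioo a b) :
    f t = f s :=
  isOpen_Ioo.is_const_of_deriv_eq_zero isPreconnected_Ioo
    (fun u hu => (hf u hu).differentiableAt.differentiableWithinAt)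
    (fun u hu => (hf u hu).deriv) ht hs

theorem regular_invariant_vs_sinTheta_p1 (m g R Js Jr τ : ℝ)
    (hm : 0 < m) (hg : 0 < g) (hR : 0 < R) (hJs : 0 < Js) (hJr : 0 < Jr)
    (a b : ℝ) (hI : (0 : ℝ) ∈ Set.Ioo a b)
    (x y θ φ vs vr p₁ p₂ : ℝ → ℝ)
    (hsol : IsRegularSolution m g R Js Jr τ (Set.Ioo a b) x y θ φ vs vr p₁ p₂)
    (hvs0 : vs 0 = 0) (hθ0 : Real.sin (θ 0) = 0) (hp10 : p₁ 0 = 0)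
    : ∀ t ∈ Set.Ioo a b, vs t = 0 ∧ Real.sin (θ t) = 0 ∧ p₁ t = 0 ∧
      (vs t ^ 2 + vr t ^ 2) * p₁ t = 0 := by
  have hvs : ∀ t ∈ Set.Ioo a b, vs t = 0 := fun t ht =>
    (eq_of_hasDerivAt_zero_Ioo (fun u hu => (hsol u hu).2.2.2.2.1) hI ht).trans hvs0
  have hθ : ∀ t ∈ Set.Ioo a b, Real.sin (θ t) = 0 := fun t ht => by
    rw [eq_of_hasDerivAt_zero_Ioo (f := θ)
      (fun u hu => by simpa [hvs u hu] using (hsol u hu).2.2.1) hI ht, hθ0]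
  have hp₁ : ∀ t ∈ Set.Ioo a b, p₁ t = 0 := fun t ht =>
    (eq_of_hasDerivAt_zero_Ioo
      (fun u hu => by simpa [hvs u hu, hθ u hu] using (hsol u hu).2.2.2.2.2.2.1) hI ht).trans hp10
  intro t ht
  exact ⟨hvs t ht, hθ t ht, hp₁ t ht, by rw [hp₁ t ht, mul_zero]⟩
end

section
/- Let x, y, θ, φ, vₛ, vᵣ, p₁, p₂ be a solution of the regular system on an open interval I containing 0, and suppose vₛ(0) = 0, vᵣ(0) = 0, and cos(θ(0)) = 0. Then for every t ∈ I one has vₛ(t) = 0, vᵣ(t) = 0, cos(θ(t)) = 0, and p₂(t) = p₂(0); in particular (vₛ(t)² + vᵣ(t)²)·p₁(t) = 0 for all t ∈ I. -/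
open Real Set

theorem regular_invariant_vs_vr_cosTheta (m g R Js Jr τ : ℝ)
    (hm : 0 < m) (hg : 0 < g) (hR : 0 < R) (hJs : 0 < Js) (hJr : 0 < Jr)
    (a b : ℝ) (hI : (0 : ℝ) ∈ Set.Ioo a b)
    (x y θ φ vs vr p₁ p₂ : ℝ → ℝ)
    (hsol : IsRegularSolution m g R Js Jr τ (Set.Ioo a b) x y θ φ vs vr p₁ p₂)
    (hvs0 : vs 0 = 0) (hvr0 : vr 0 = 0) (hθ0 : Real.cos (θ 0) = 0)
    : ∀ t ∈ Set.Ioo a b, vs t = 0 ∧ vr t = 0 ∧ Real.cos (θ t) = 0 ∧ p₂ t = p₂ 0 ∧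
      (vs t ^ 2 + vr t ^ 2) * p₁ t = 0 := by
  have hvs : ∀ t ∈ Set.Ioo a b, vs t = 0 := fun t ht =>
    (eq_of_hasDerivAt_zero_Ioo (fun u hu => (hsol u hu).2.2.2.2.1) hI ht).trans hvs0
  have hcos : ∀ t ∈ Set.Ioo a b, Real.cos (θ t) = 0 := fun t ht => by
    rw [eq_of_hasDerivAt_zero_Ioo (f := θ) (fun u hu => ?_) hI ht, hθ0]
    simpa [hvs u hu] using (hsol u hu).2.2.1
  have hvr : ∀ t ∈ Set.Ioo a b, vr t = 0 := fun t ht => by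
    rw [eq_of_hasDerivAt_zero_Ioo (f := vr) (fun u hu => ?_) hI ht, hvr0]
    simpa [hcos u hu] using (hsol u hu).2.2.2.2.2.1
  intro t ht
  refine ⟨hvs t ht, hvr t ht, hcos t ht,
    eq_of_hasDerivAt_zero_Ioo (fun u hu => ?_) hI ht, by simp [hvs t ht, hvr t ht]⟩
  simpa [hvs u hu, hcos u hu] using (hsol u hu).2.2.2.2.2.2.2
end

section
/- Assume sin(τ) ≠ 0, and let x, y, θ, φ, vₛ, vᵣ, p₁, p₂ be a solution of the regular system on a nondegenerate open interval I containing 0. Then (vₛ(t)² + vᵣ(t)²)·p₁(t) = 0 holds for all t ∈ I if and only if vₛ(0) = 0 and at least one of the following two conditions holds: (a) sin(θ(0)) = 0 and p₁(0) = 0; (b) vᵣ(0) = 0 and cos(θ(0)) = 0. -/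
open Real Set

lemma HasDerivAt.eq_zero_of_forall_Ioo_eq_zero {f : ℝ → ℝ} {f' a b t : ℝ}
    (h0 : ∀ s ∈ Set.Ioo a b, f s = 0) (ht : t ∈ Set.Ioo a b) (hf : HasDerivAt f f' t) :
    f' = 0 := by
  refine hf.unique ((hasDerivAt_const t (0 : ℝ)).congr_of_eventuallyEq ?_)
  filter_upwards [isOpen_Ioo.mem_nhds ht] with s hs using h0 s hs

lemma eq_add_mul_of_hasDerivAt_Ioo {f : ℝ → ℝ} {a b c : ℝ} (h0 : (0 : ℝ) ∈ Set.Ioo a b)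
    (hf : ∀ t ∈ Set.Ioo a b, HasDerivAt f c t) : ∀ t ∈ Set.Ioo a b, f t = f 0 + c * t := by
  intro t ht
  have hd : ∀ s ∈ Set.Ioo a b, HasDerivAt (fun u => f u - c * u) 0 s := fun s hs =>
    ((hf s hs).sub ((hasDerivAt_id s).const_mul c)).congr_deriv (by simp)
  have h := isOpen_Ioo.is_const_of_deriv_eq_zero isPreconnected_Ioo
    (fun s hs => (hd s hs).differentiableAt.differentiableWithinAt)
    (fun s hs => (hd s hs).deriv) ht h0
  simp only [mul_zero, sub_zero] at h
  linarith

/-- If the square of one affine function times another vanishes on a nonempty open interval,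
then one of the two affine functions is identically zero. -/
lemma affine_eq_zero_of_sq_mul_eq_zero {a b u A v B : ℝ} (hab : a < b)
    (h : ∀ t ∈ Set.Ioo a b, (u + A * t) ^ 2 * (v + B * t) = 0) :
    (u = 0 ∧ A = 0) ∨ (v = 0 ∧ B = 0) := by
  open Polynomial in
  have coeffs : ∀ p q : ℝ, (C p + C q * X : ℝ[X]) = 0 → p = 0 ∧ q = 0 := fun p q hpq =>
    ⟨by simpa using congrArg (fun r => r.coeff 0) hpq,
      by simpa [coeff_C] using congrArg (fun r => r.coeff 1) hpq⟩
  have hz : ((Polynomial.C u + Polynomial.C A * Polynomial.X) ^ 2 *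
      (Polynomial.C v + Polynomial.C B * Polynomial.X) : Polynomial ℝ) = 0 :=
    Polynomial.eq_zero_of_infinite_isRoot _
      ((Set.Ioo_infinite hab).mono fun t ht => by simpa using h t ht)
  rcases mul_eq_zero.mp hz with hu | hv
  · exact Or.inl (coeffs _ _ (pow_eq_zero_iff two_ne_zero |>.mp hu))
  · exact Or.inr (coeffs _ _ hv)

/-- If `p₁` vanishes identically along a regular solution on an inclined plane, the disc does not
spin. -/
lemma IsRegularSolution.vs_eq_zero {m g R Js Jr τ a b : ℝ}
    (hm : 0 < m) (hg : 0 < g) (hJs : 0 < Js) (hJr : 0 < Jr)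
    (hI : (0 : ℝ) ∈ Set.Ioo a b) {x y θ φ vs vr p₁ p₂ : ℝ → ℝ}
    (hsol : IsRegularSolution m g R Js Jr τ (Set.Ioo a b) x y θ φ vs vr p₁ p₂)
    (hτ : Real.sin τ ≠ 0) (hvs : ∀ t ∈ Set.Ioo a b, vs t = vs 0)
    (hp : ∀ t ∈ Set.Ioo a b, p₁ t = 0) : vs 0 = 0 := by
  by_contra hc
  have hα2 : 0 < Jr + m * R ^ 2 := by positivity
  have hα := Real.sqrt_pos.mpr hα2
  have hsm := Real.sqrt_pos.mpr hm
  have hsJs := Real.sqrt_pos.mpr hJs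
  have hcos : ∀ t ∈ Set.Ioo a b, Real.cos (θ t) = 0 := by
    intro t ht
    obtain ⟨-, -, hθ, -, hv, hr, -, h2⟩ := hsol t ht
    have hforce : ∀ s ∈ Set.Ioo a b,
        (Real.sqrt Jr * vs s * p₂ s - 2 * Real.sqrt m * R * vs s * vr s) /
          (Real.sqrt Js * Real.sqrt (Jr + m * R ^ 2)) -
        Real.sqrt m * g * Real.sin τ * Real.sin (θ s) = 0 := fun s hs =>
      HasDerivAt.eq_zero_of_forall_Ioo_eq_zero hp hs (hsol s hs).2.2.2.2.2.2.1
    have hd := HasDerivAt.eq_zero_of_forall_Ioo_eq_zero hforce ht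
      (((((hv.const_mul (Real.sqrt Jr)).mul h2).sub
        ((hv.const_mul (2 * Real.sqrt m * R)).mul hr)).div_const _).sub
        (hθ.sin.const_mul (Real.sqrt m * g * Real.sin τ)))
    rw [hvs t ht, hp t ht] at hd
    generalize Real.sqrt (Jr + m * R ^ 2) = α at *
    generalize Real.sqrt m = μ at *
    generalize Real.sqrt Js = σ at *
    generalize Real.sqrt Jr = ρ at *
    have hfac : σ * μ * g * Real.sin τ * vs 0 * (ρ ^ 2 + 2 * m * R ^ 2 + α ^ 2) *
        Real.cos (θ t) = 0 := by
      field_simp at hd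
      linear_combination (-1) * hd
    have hpos : 0 < ρ ^ 2 + 2 * m * R ^ 2 + α ^ 2 := by positivity
    simpa [hsJs.ne', hsm.ne', hg.ne', hτ, hc, hpos.ne'] using hfac
  have hd := HasDerivAt.eq_zero_of_forall_Ioo_eq_zero hcos hI (hsol 0 hI).2.2.1.cos
  have hsin : Real.sin (θ 0) = 0 := by simpa [hc, hsJs.ne'] using hd
  simpa [hsin, hcos 0 hI] using Real.sin_sq_add_cos_sq (θ 0)

theorem regular_classification_inclined (m g R Js Jr τ : ℝ)
    (hm : 0 < m) (hg : 0 < g) (hR : 0 < R) (hJs : 0 < Js) (hJr : 0 < Jr)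
    (a b : ℝ) (hI : (0 : ℝ) ∈ Set.Ioo a b)
    (x y θ φ vs vr p₁ p₂ : ℝ → ℝ)
    (hsol : IsRegularSolution m g R Js Jr τ (Set.Ioo a b) x y θ φ vs vr p₁ p₂)
    (hτ : Real.sin τ ≠ 0)
    : (∀ t ∈ Set.Ioo a b, (vs t ^ 2 + vr t ^ 2) * p₁ t = 0) ↔
      (vs 0 = 0 ∧ ((Real.sin (θ 0) = 0 ∧ p₁ 0 = 0) ∨ (vr 0 = 0 ∧ Real.cos (θ 0) = 0))) := by
  have hα := Real.sqrt_pos.mpr (show 0 < Jr + m * R ^ 2 by positivity)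
  have hsm := Real.sqrt_pos.mpr hm
  have hvs : ∀ t ∈ Set.Ioo a b, vs t = vs 0 := fun t ht => by
    simpa using eq_add_mul_of_hasDerivAt_Ioo hI (fun s hs => (hsol s hs).2.2.2.2.1) t ht
  have hvs0 : (∀ t ∈ Set.Ioo a b, (vs t ^ 2 + vr t ^ 2) * p₁ t = 0) → vs 0 = 0 := fun h => by
    by_contra hc
    refine hc (hsol.vs_eq_zero hm hg hJs hJr hI hτ hvs fun t ht => ?_)
    have hpos : 0 < vs t ^ 2 + vr t ^ 2 := by
      rw [hvs t ht]
      positivity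
    exact (mul_eq_zero.mp (h t ht)).resolve_left hpos.ne'
  rw [← and_iff_right_of_imp hvs0]
  refine and_congr_right fun h0 => ?_
  have hθ : ∀ t ∈ Set.Ioo a b, θ t = θ 0 := fun t ht => by
    simpa using eq_add_mul_of_hasDerivAt_Ioo (c := 0) hI
      (fun s hs => by simpa [hvs s hs, h0] using (hsol s hs).2.2.1) t ht
  have hvr := eq_add_mul_of_hasDerivAt_Ioo
    (c := m * g * R * Real.sin τ * Real.cos (θ 0) / Real.sqrt (Jr + m * R ^ 2)) hI
    (fun s hs => by simpa only [hθ s hs] using (hsol s hs).2.2.2.2.2.1)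
  have hp := eq_add_mul_of_hasDerivAt_Ioo
    (c := -(Real.sqrt m * g * Real.sin τ * Real.sin (θ 0))) hI
    (fun s hs => by simpa [hvs s hs, h0, hθ s hs] using (hsol s hs).2.2.2.2.2.2.1)
  constructor
  · intro h
    have hprod : ∀ t ∈ Set.Ioo a b, vr t ^ 2 * p₁ t = 0 := fun t ht => by
      simpa [hvs t ht, h0] using h t ht
    rcases affine_eq_zero_of_sq_mul_eq_zero (hI.1.trans hI.2) (fun t ht =>
      hvr t ht ▸ hp t ht ▸ hprod t ht) with ⟨hr, hA⟩ | ⟨hp0, hB⟩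
    · exact Or.inr ⟨hr, by simpa [hm.ne', hg.ne', hR.ne', hτ, hα.ne'] using hA⟩
    · exact Or.inl ⟨by simpa [hsm.ne', hg.ne', hτ] using hB, hp0⟩
  · rintro (⟨hs, hp0⟩ | ⟨hr, hc⟩) t ht
    · simp [hp t ht, hs, hp0]
    · simp [hvs t ht, h0, hvr t ht, hr, hc]
end

section
/- Assume sin(τ) = 0. Let x, y, θ, φ, vₛ, vᵣ, p₁, p₂ be a solution of the regular system on an open interval I containing 0 with p₁(0) = 0 and p₂(0) = (2·√m·R/√Jᵣ)·vᵣ(0). Then for every t ∈ I one has vᵣ(t) = vᵣ(0), p₁(t) = 0, and p₂(t) = (2·√m·R/√Jᵣ)·vᵣ(t); in particular (vₛ(t)² + vᵣ(t)²)·p₁(t) = 0 for all t ∈ I. -/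
open Real Set

theorem regular_horizontal_affine_invariant (m g R Js Jr τ : ℝ)
    (hm : 0 < m) (hg : 0 < g) (hR : 0 < R) (hJs : 0 < Js) (hJr : 0 < Jr)
    (a b : ℝ) (hI : (0 : ℝ) ∈ Set.Ioo a b)
    (x y θ φ vs vr p₁ p₂ : ℝ → ℝ)
    (hsol : IsRegularSolution m g R Js Jr τ (Set.Ioo a b) x y θ φ vs vr p₁ p₂)
    (hτ : Real.sin τ = 0) (hp10 : p₁ 0 = 0)
    (hp20 : p₂ 0 = 2 * Real.sqrt m * R / Real.sqrt Jr * vr 0)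
    : ∀ t ∈ Set.Ioo a b, vr t = vr 0 ∧ p₁ t = 0 ∧
      p₂ t = 2 * Real.sqrt m * R / Real.sqrt Jr * vr t ∧
      (vs t ^ 2 + vr t ^ 2) * p₁ t = 0 := by
  set c := 2 * Real.sqrt m * R / Real.sqrt Jr with hc
  have hcJ : Real.sqrt Jr * c = 2 * Real.sqrt m * R :=
    mul_div_cancel₀ _ (Real.sqrt_pos.2 hJr).ne'
  have hvr : ∀ u ∈ Set.Ioo a b, HasDerivAt vr 0 u := fun u hu => by
    simpa [hτ] using (hsol u hu).2.2.2.2.2.1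
  have henergy : ∀ u ∈ Set.Ioo a b,
      HasDerivAt (fun u => p₁ u ^ 2 + (p₂ u - c * vr u) ^ 2) 0 u := fun u hu => by
    obtain ⟨-, -, -, -, -, -, h₁, h₂⟩ := hsol u hu
    refine ((h₁.pow 2).add ((h₂.sub ((hvr u hu).const_mul c)).pow 2)).congr_deriv ?_
    simp only [hτ, ← hcJ, Pi.sub_apply]
    ring
  intro t ht
  have hE : p₁ t ^ 2 + (p₂ t - c * vr t) ^ 2 = 0 := by
    simpa [hp10, hp20] using eq_of_hasDerivAt_zero_Ioo henergy hI ht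
  have hp₁ : p₁ t = 0 := by nlinarith [sq_nonneg (p₁ t), sq_nonneg (p₂ t - c * vr t)]
  have hp₂ : p₂ t - c * vr t = 0 := by nlinarith [sq_nonneg (p₂ t - c * vr t)]
  exact ⟨eq_of_hasDerivAt_zero_Ioo hvr hI ht, hp₁, sub_eq_zero.1 hp₂, by rw [hp₁, mul_zero]⟩
end

section
/- Assume sin(τ) = 0. Let x, y, θ, φ, vₛ, vᵣ, p₁, p₂ be a solution of the regular system on an open interval I containing 0 with vₛ(0) = 0 and p₁(0) = 0. Then for every t ∈ I one has vₛ(t) = 0, p₁(t) = 0, and p₂(t) = p₂(0); in particular (vₛ(t)² + vᵣ(t)²)·p₁(t) = 0 for all t ∈ I. -/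
open Real Set

/-- A function with vanishing derivative on an open interval is constant there. -/
theorem eq_of_hasDerivAt_zero_on_Ioo {f : ℝ → ℝ} {a b s t : ℝ}
    (hf : ∀ u ∈ Set.Ioo a b, HasDerivAt f 0 u) (hs : s ∈ Set.Ioo a b) (ht : t ∈ Set.Ioo a b) :
    f s = f t :=
  isOpen_Ioo.is_const_of_deriv_eq_zero isPreconnected_Ioo
    (fun u hu => (hf u hu).differentiableAt.differentiableWithinAt)
    (fun u hu => (hf u hu).deriv) hs ht

theorem regular_horizontal_invariant_vs_p1 (m g R Js Jr τ : ℝ)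
    (hm : 0 < m) (hg : 0 < g) (hR : 0 < R) (hJs : 0 < Js) (hJr : 0 < Jr)
    (a b : ℝ) (hI : (0 : ℝ) ∈ Set.Ioo a b)
    (x y θ φ vs vr p₁ p₂ : ℝ → ℝ)
    (hsol : IsRegularSolution m g R Js Jr τ (Set.Ioo a b) x y θ φ vs vr p₁ p₂)
    (hτ : Real.sin τ = 0) (hvs0 : vs 0 = 0) (hp10 : p₁ 0 = 0)
    : ∀ t ∈ Set.Ioo a b, vs t = 0 ∧ p₁ t = 0 ∧ p₂ t = p₂ 0 ∧
      (vs t ^ 2 + vr t ^ 2) * p₁ t = 0 := by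
  have hvs : ∀ t ∈ Set.Ioo a b, vs t = 0 := fun t ht =>
    (eq_of_hasDerivAt_zero_on_Ioo (fun u hu => (hsol u hu).2.2.2.2.1) ht hI).trans hvs0
  have hp₁ : ∀ t ∈ Set.Ioo a b, p₁ t = 0 := fun t ht =>
    (eq_of_hasDerivAt_zero_on_Ioo (fun u hu => by
      simpa [hvs u hu, hτ] using (hsol u hu).2.2.2.2.2.2.1) ht hI).trans hp10
  have hp₂ : ∀ t ∈ Set.Ioo a b, p₂ t = p₂ 0 := fun t ht =>
    eq_of_hasDerivAt_zero_on_Ioo (fun u hu => by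
      simpa [hvs u hu, hτ] using (hsol u hu).2.2.2.2.2.2.2) ht hI
  exact fun t ht => ⟨hvs t ht, hp₁ t ht, hp₂ t ht, by rw [hp₁ t ht, mul_zero]⟩
end

section
/- Let x, y, θ, φ, vₛ, vᵣ, p₁, p₂ be a solution of the singular system on an open interval I containing 0 with vₛ(0) = 0 and p₁(0) = 0. Then for every t ∈ I one has vₛ(t) = 0, p₁(t) = 0, and p₂(t) = p₂(0); in particular (vₛ(t)² + vᵣ(t)²)·p₁(t) = 0 for all t ∈ I. -/
open Real Set

/-- A solution of the reduced ODE system governing the D-singular constrained variational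
trajectories of a disc (mass `m`, radius `R`, spinning inertia `Js`, rolling inertia `Jr`)
rolling without slip on a plane inclined at angle `τ`, on a set `I ⊆ ℝ`. -/
def IsSingularSolution (m g R Js Jr τ : ℝ) (I : Set ℝ)
    (x y θ φ vs vr p₁ p₂ : ℝ → ℝ) : Prop :=
  ∀ t ∈ I,
    HasDerivAt x (R * Real.cos (θ t) * vr t / Real.sqrt (Jr + m * R ^ 2)) t ∧
    HasDerivAt y (R * Real.sin (θ t) * vr t / Real.sqrt (Jr + m * R ^ 2)) t ∧
    HasDerivAt θ (vs t / Real.sqrt Js) t ∧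
    HasDerivAt φ (vr t / Real.sqrt (Jr + m * R ^ 2)) t ∧
    HasDerivAt vs 0 t ∧
    HasDerivAt vr (m * g * R * Real.sin τ * Real.cos (θ t) / Real.sqrt (Jr + m * R ^ 2)) t ∧
    HasDerivAt p₁
      (Real.sqrt Jr * vs t * p₂ t / (Real.sqrt Js * Real.sqrt (Jr + m * R ^ 2))) t ∧
    HasDerivAt p₂
      (-(Real.sqrt Jr * vs t * p₁ t) / (Real.sqrt Js * Real.sqrt (Jr + m * R ^ 2))) t

theorem singular_invariant_vs_p1 (m g R Js Jr τ : ℝ)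
    (hm : 0 < m) (hg : 0 < g) (hR : 0 < R) (hJs : 0 < Js) (hJr : 0 < Jr)
    (a b : ℝ) (hI : (0 : ℝ) ∈ Set.Ioo a b)
    (x y θ φ vs vr p₁ p₂ : ℝ → ℝ)
    (hsol : IsSingularSolution m g R Js Jr τ (Set.Ioo a b) x y θ φ vs vr p₁ p₂)
    (hvs0 : vs 0 = 0) (hp10 : p₁ 0 = 0)
    : ∀ t ∈ Set.Ioo a b, vs t = 0 ∧ p₁ t = 0 ∧ p₂ t = p₂ 0 ∧
      (vs t ^ 2 + vr t ^ 2) * p₁ t = 0 := by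
  have vs_eq : ∀ t ∈ Set.Ioo a b, vs t = 0 := fun t ht =>
    (eq_of_hasDerivAt_zero_on_Ioo (fun s hs => (hsol s hs).2.2.2.2.1) ht hI).trans hvs0
  have p₁_eq : ∀ t ∈ Set.Ioo a b, p₁ t = 0 := fun t ht =>
    (eq_of_hasDerivAt_zero_on_Ioo
      (fun s hs => by simpa [vs_eq s hs] using (hsol s hs).2.2.2.2.2.2.1) ht hI).trans hp10
  have p₂_eq : ∀ t ∈ Set.Ioo a b, p₂ t = p₂ 0 := fun t ht =>
    eq_of_hasDerivAt_zero_on_Ioo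
      (fun s hs => by simpa [vs_eq s hs] using (hsol s hs).2.2.2.2.2.2.2) ht hI
  exact fun t ht => ⟨vs_eq t ht, p₁_eq t ht, p₂_eq t ht, by simp [p₁_eq t ht]⟩
end

section
/- Let x, y, θ, φ, vₛ, vᵣ, p₁, p₂ be a solution of the singular system on an open interval I containing 0 with p₁(0) = 0 and p₂(0) = 0. Then p₁(t) = 0 and p₂(t) = 0 for every t ∈ I. -/
open Real Set

theorem singular_invariant_p1_p2_zero (m g R Js Jr τ : ℝ)
    (hm : 0 < m) (hg : 0 < g) (hR : 0 < R) (hJs : 0 < Js) (hJr : 0 < Jr)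
    (a b : ℝ) (hI : (0 : ℝ) ∈ Set.Ioo a b)
    (x y θ φ vs vr p₁ p₂ : ℝ → ℝ)
    (hsol : IsSingularSolution m g R Js Jr τ (Set.Ioo a b) x y θ φ vs vr p₁ p₂)
    (hp10 : p₁ 0 = 0) (hp20 : p₂ 0 = 0)
    : ∀ t ∈ Set.Ioo a b, p₁ t = 0 ∧ p₂ t = 0 := by
  have hderiv : ∀ t ∈ Set.Ioo a b, HasDerivAt (fun s => p₁ s ^ 2 + p₂ s ^ 2) 0 t := by
    intro t ht
    obtain ⟨-, -, -, -, -, -, h₁, h₂⟩ := hsol t ht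
    refine ((h₁.pow 2).add (h₂.pow 2)).congr_deriv ?_
    push_cast
    ring
  intro t ht
  have hconst : p₁ t ^ 2 + p₂ t ^ 2 = p₁ 0 ^ 2 + p₂ 0 ^ 2 :=
    isOpen_Ioo.is_const_of_deriv_eq_zero isPreconnected_Ioo
      (fun s hs => (hderiv s hs).differentiableAt.differentiableWithinAt)
      (fun s hs => (hderiv s hs).deriv) ht hI
  rw [hp10, hp20] at hconst
  constructor <;> nlinarith [sq_nonneg (p₁ t), sq_nonneg (p₂ t)]
end

section
/- Let x, y, θ, φ, vₛ, vᵣ, p₁, p₂ be a solution of the singular system on an open interval I containing 0 with vₛ(0) = 0, vᵣ(0) = 0, and cos(θ(0)) = 0. Then for every t ∈ I one has vₛ(t) = 0, vᵣ(t) = 0, cos(θ(t)) = 0, p₁(t) = p₁(0), and p₂(t) = p₂(0); in particular (vₛ(t)² + vᵣ(t)²)·p₁(t) = 0 for all t ∈ I. -/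
open Real Set

theorem singular_invariant_vs_vr_cosTheta (m g R Js Jr τ : ℝ)
    (hm : 0 < m) (hg : 0 < g) (hR : 0 < R) (hJs : 0 < Js) (hJr : 0 < Jr)
    (a b : ℝ) (hI : (0 : ℝ) ∈ Set.Ioo a b)
    (x y θ φ vs vr p₁ p₂ : ℝ → ℝ)
    (hsol : IsSingularSolution m g R Js Jr τ (Set.Ioo a b) x y θ φ vs vr p₁ p₂)
    (hvs0 : vs 0 = 0) (hvr0 : vr 0 = 0) (hθ0 : Real.cos (θ 0) = 0)
    : ∀ t ∈ Set.Ioo a b, vs t = 0 ∧ vr t = 0 ∧ Real.cos (θ t) = 0 ∧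
      p₁ t = p₁ 0 ∧ p₂ t = p₂ 0 ∧ (vs t ^ 2 + vr t ^ 2) * p₁ t = 0 := by
  have hvs : ∀ t ∈ Set.Ioo a b, vs t = 0 := fun t ht =>
    (eq_of_hasDerivAt_zero_on_Ioo (fun u hu => (hsol u hu).2.2.2.2.1) ht hI).trans hvs0
  have hcos : ∀ t ∈ Set.Ioo a b, Real.cos (θ t) = 0 := by
    intro t ht
    rw [eq_of_hasDerivAt_zero_on_Ioo (f := θ) (fun u hu => ?_) ht hI, hθ0]
    simpa [hvs u hu] using (hsol u hu).2.2.1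
  have hvr : ∀ t ∈ Set.Ioo a b, vr t = 0 := by
    intro t ht
    rw [eq_of_hasDerivAt_zero_on_Ioo (f := vr) (fun u hu => ?_) ht hI, hvr0]
    simpa [hcos u hu] using (hsol u hu).2.2.2.2.2.1
  intro t ht
  refine ⟨hvs t ht, hvr t ht, hcos t ht,
    eq_of_hasDerivAt_zero_on_Ioo (fun u hu => ?_) ht hI,
    eq_of_hasDerivAt_zero_on_Ioo (fun u hu => ?_) ht hI, by simp [hvs t ht, hvr t ht]⟩
  · simpa [hvs u hu] using (hsol u hu).2.2.2.2.2.2.1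
  · simpa [hvs u hu] using (hsol u hu).2.2.2.2.2.2.2
end
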